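/- The only irreducible 𝔤_{Tr-IMM}-invariant subspaces of Fⁿ are U_0, ..., U_{d-1}, where U_k is the coordinate subspace spanned by the standard basis vectors indexed by the variables x_k. -/

import Mathlib

open Matrix MvPolynomial

/-- The `k`-th symbolic matrix `Q_k` of `Tr-IMM_{w,d}`. -/
noncomputable def symQ (F : Type*) [Field F] (w d : ℕ) (k : Fin d) :
    Matrix (Fin w) (Fin w) (MvPolynomial (Fin d × Fin w × Fin w) F) :=
  fun i j => MvPolynomial.X (k, i, j)

/-- `Tr-IMM_{w,d} = tr(Q_0 Q_1 ⋯ Q_{d-1})`. -/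
noncomputable def trIMM (F : Type*) [Field F] (w d : ℕ) :
    MvPolynomial (Fin d × Fin w × Fin w) F :=
  Matrix.trace (((List.finRange d).map (symQ F w d)).prod)

/-- The Lie algebra of a polynomial `f`. -/
def lieAlg {F : Type*} [Field F] {σ : Type*} [Fintype σ] [DecidableEq σ]
    (f : MvPolynomial σ F) : Set (Matrix σ σ F) :=
  {E | ∑ i : σ, ∑ j : σ, E i j • (MvPolynomial.X j * MvPolynomial.pderiv i f) = 0}

/-- `U` is invariant under the set of matrices `L`. -/
def LieInvariant {F : Type*} [Field F] {ι : Type*} [Fintype ι]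
    (L : Set (Matrix ι ι F)) (U : Submodule F (ι → F)) : Prop :=
  ∀ M ∈ L, ∀ u ∈ U, M.mulVec u ∈ U

/-- `U` is a nonzero `L`-invariant subspace that is not the direct sum of two
proper nonzero `L`-invariant subspaces. -/
def IsIrreducibleInvariant {F : Type*} [Field F] {ι : Type*} [Fintype ι]
    (L : Set (Matrix ι ι F)) (U : Submodule F (ι → F)) : Prop :=
  U ≠ ⊥ ∧ LieInvariant L U ∧
    ¬ ∃ U₁ U₂ : Submodule F (ι → F), LieInvariant L U₁ ∧ LieInvariant L U₂ ∧
      U₁ ≠ ⊥ ∧ U₂ ≠ ⊥ ∧ U₁ < U ∧ U₂ < U ∧ U₁ ⊔ U₂ = U ∧ U₁ ⊓ U₂ = ⊥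

theorem trace_list_prod_of_isRotated {R n : Type*} [CommRing R] [Fintype n] [DecidableEq n]
    {l l' : List (Matrix n n R)} (h : l ~r l') : l.prod.trace = l'.prod.trace := by
  obtain ⟨m, rfl⟩ := h
  obtain ⟨s, t, hl, hr⟩ : ∃ s t : List (Matrix n n R), l = s ++ t ∧ l.rotate m = t ++ s :=
    ⟨l.take (m % l.length), l.drop (m % l.length), by simp, List.rotate_eq_drop_append_take_mod⟩
  rw [hr, hl, List.prod_append, List.prod_append, Matrix.trace_mul_comm]

/-- Any element of a list can be rotated to the front. -/
theorem exists_isRotated_cons {α : Type*} {l : List α} {a : α} (h : a ∈ l) :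
    ∃ t, (a :: t) ~r l := by
  obtain ⟨s, t, rfl⟩ := List.append_of_mem h
  exact ⟨t ++ s, by simpa using (List.isRotated_append (l := a :: t) (l' := s))⟩

theorem aeval_inl_add_inr {F R σ : Type*} [Field F] [CommRing R] [Algebra F R] [Fintype σ]
    (x y : σ → R) (p : MvPolynomial σ F) :
    aeval (fun i => (TrivSqZeroExt.inl (x i) + TrivSqZeroExt.inr (y i) : TrivSqZeroExt R R)) p =
      TrivSqZeroExt.inl (aeval x p) + TrivSqZeroExt.inr (∑ i, y i * aeval x (pderiv i p)) := by
  classical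
  induction p using MvPolynomial.induction_on with
  | C a => simp [TrivSqZeroExt.algebraMap_eq_inl']
  | add p q hp hq =>
    rw [map_add, hp, hq]
    ext <;> simp [mul_add, Finset.sum_add_distrib]
  | mul_X p j hp =>
    rw [map_mul, hp]
    ext
    · simp
    · simp [pderiv_X, Pi.single_apply, mul_add, Finset.sum_add_distrib,
        Finset.sum_mul, apply_ite]
      rw [add_comm]
      congr 1
      exact Finset.sum_congr rfl fun i _ => by ring

theorem aeval_trIMM {F R : Type*} [Field F] [CommRing R] [Algebra F R] {w d : ℕ}
    (g : Fin d × Fin w × Fin w → R) :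
    aeval g (trIMM F w d) = Matrix.trace (((List.finRange d).map
      fun k => Matrix.of fun i j => g (k, i, j)).prod) := by
  have h : aeval g (trIMM F w d) = Matrix.trace
      ((aeval (R := F) g).mapMatrix ((List.finRange d).map (symQ F w d)).prod) :=
    AddMonoidHom.map_trace (aeval (R := F) g) _
  rw [h, map_list_prod, List.map_map]
  congr 3
  funext k
  ext i j
  simp [symQ]

/-- `E` kills `f` iff the first-order deformation `x ↦ x + ε E x` fixes `f`. -/
theorem mem_lieAlg_iff {F σ : Type*} [Field F] [Fintype σ] [DecidableEq σ]
    (f : MvPolynomial σ F) (E : Matrix σ σ F) :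
    E ∈ lieAlg f ↔ (aeval (fun i => (TrivSqZeroExt.inl (X i) +
      TrivSqZeroExt.inr (∑ j, E i j • X j) :
        TrivSqZeroExt (MvPolynomial σ F) (MvPolynomial σ F))) f).snd = 0 := by
  rw [aeval_inl_add_inr]
  simp [lieAlg, Finset.sum_mul]

theorem snd_aeval_of_mem_lieAlg {F σ : Type*} [Field F] [Fintype σ] [DecidableEq σ]
    {f : MvPolynomial σ F} {E : Matrix σ σ F} (hE : E ∈ lieAlg f) (x : σ → F) :
    (aeval (fun i => (TrivSqZeroExt.inl (x i) +
      TrivSqZeroExt.inr ((E *ᵥ x) i) : TrivSqZeroExt F F)) f).snd = 0 := by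
  rw [aeval_inl_add_inr]
  have h := congrArg (aeval x) (show _ = _ from hE)
  simpa [Matrix.mulVec, dotProduct, Finset.sum_mul, mul_assoc] using h

theorem mul_one_add_mul_one_sub_mul {S : Type*} [Ring S] {b : S} (h : b * b = 0) (a c : S) :
    a * (1 + b) * ((1 - b) * c) = a * c := by
  have : (1 + b) * (1 - b) = 1 := by
    rw [add_mul, mul_sub, mul_sub, h]
    simp
  rw [mul_assoc, ← mul_assoc (1 + b), this, one_mul]

/-- The matrix of the infinitesimal symmetry `Q_p ↦ Q_p A`, `Q_q ↦ -A Q_q`. -/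
def gaugeMatrix {F : Type*} [Field F] {w d : ℕ} (p q : Fin d) (A : Matrix (Fin w) (Fin w) F) :
    Matrix (Fin d × Fin w × Fin w) (Fin d × Fin w × Fin w) F :=
  fun x y =>
    (if y.1 = p then if y.2.1 = x.2.1 then if x.1 = p then A y.2.2 x.2.2 else 0 else 0 else 0) -
    (if y.1 = q then if y.2.2 = x.2.2 then if x.1 = q then A x.2.1 y.2.1 else 0 else 0 else 0)

theorem sum_gaugeMatrix_smul {F M : Type*} [Field F] [AddCommGroup M] [Module F M] {w d : ℕ}
    (p q : Fin d) (A : Matrix (Fin w) (Fin w) F) (y : Fin d × Fin w × Fin w → M)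
    (k : Fin d) (i j : Fin w) :
    ∑ z, gaugeMatrix p q A (k, i, j) z • y z =
      (if k = p then ∑ a, A a j • y (p, i, a) else 0) -
      (if k = q then ∑ a, A i a • y (q, a, j) else 0) := by
  simp only [gaugeMatrix, sub_smul, Finset.sum_sub_distrib, Fintype.sum_prod_type, ite_smul,
    zero_smul]
  congr 1
  · simp [Finset.sum_ite_irrel]
  · simp [Finset.sum_ite_irrel]

/-- The deformation `x ↦ x + ε E x`, with `E` a gauge matrix, fixes the cyclic product. -/
theorem trace_prod_gaugeMatrix {F R : Type*} [Field F] [CommRing R] [Algebra F R] {w d : ℕ}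
    {p q : Fin d} {t : List (Fin d)} (hnd : (p :: q :: t).Nodup) (A : Matrix (Fin w) (Fin w) F)
    (y : Fin d × Fin w × Fin w → R) :
    ((p :: q :: t).map fun k => (Matrix.of fun i j => TrivSqZeroExt.inl (y (k, i, j)) +
      TrivSqZeroExt.inr (∑ z, gaugeMatrix p q A (k, i, j) z • y z) :
        Matrix (Fin w) (Fin w) (TrivSqZeroExt R R))).prod =
    ((p :: q :: t).map fun k => (Matrix.of fun i j => TrivSqZeroExt.inl (y (k, i, j)) :
        Matrix (Fin w) (Fin w) (TrivSqZeroExt R R))).prod := by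
  obtain ⟨hpq, hpt, hqt⟩ : p ≠ q ∧ p ∉ t ∧ q ∉ t := by
    simp only [List.nodup_cons, List.mem_cons, not_or] at hnd
    exact ⟨hnd.1.1, hnd.1.2, hnd.2.1⟩
  simp only [sum_gaugeMatrix_smul, List.map_cons, List.prod_cons, hpq, hpq.symm, if_true,
    if_false, sub_zero, zero_sub]
  set B : Matrix (Fin w) (Fin w) (TrivSqZeroExt R R) :=
    A.map fun a => TrivSqZeroExt.inr (algebraMap F R a) with hB
  have hBB : B * B = 0 := by
    ext i j <;> simp [hB, Matrix.mul_apply]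
  have hp : (Matrix.of fun i j => TrivSqZeroExt.inl (y (p, i, j)) +
      TrivSqZeroExt.inr (∑ a, A a j • y (p, i, a)) : Matrix (Fin w) (Fin w) (TrivSqZeroExt R R)) =
      (Matrix.of fun i j => TrivSqZeroExt.inl (y (p, i, j))) * (1 + B) := by
    rw [mul_add, mul_one]
    ext i j
    · simp [hB, Matrix.mul_apply, TrivSqZeroExt.fst_sum]
    · simp [hB, Matrix.mul_apply, TrivSqZeroExt.snd_sum, TrivSqZeroExt.fst_sum,
        Algebra.smul_def, mul_comm, TrivSqZeroExt.algebraMap_eq_inl]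
  have hq : (Matrix.of fun i j => TrivSqZeroExt.inl (y (q, i, j)) +
      TrivSqZeroExt.inr (-∑ a, A i a • y (q, a, j)) :
        Matrix (Fin w) (Fin w) (TrivSqZeroExt R R)) =
      (1 - B) * (Matrix.of fun i j => TrivSqZeroExt.inl (y (q, i, j))) := by
    rw [sub_mul, one_mul]
    ext i j
    · simp [hB, Matrix.mul_apply, TrivSqZeroExt.fst_sum]
    · simp [hB, Matrix.mul_apply, TrivSqZeroExt.snd_sum, Algebra.smul_def, mul_comm,
        TrivSqZeroExt.algebraMap_eq_inl]
  rw [hp, hq, mul_assoc (1 - B), mul_one_add_mul_one_sub_mul hBB]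
  congr 3
  refine List.map_congr_left fun k hk => ?_
  simp [show k ≠ p from fun h => hpt (h ▸ hk), show k ≠ q from fun h => hqt (h ▸ hk)]

theorem gaugeMatrix_mem_lieAlg {F : Type*} [Field F] {w d : ℕ} {p q : Fin d} {t : List (Fin d)}
    (h : (p :: q :: t) ~r List.finRange d) (A : Matrix (Fin w) (Fin w) F) :
    gaugeMatrix p q A ∈ lieAlg (trIMM F w d) := by
  have h0 := congrArg TrivSqZeroExt.snd
    (aeval_inl_add_inr (F := F) (X : _ → MvPolynomial (Fin d × Fin w × Fin w) F) 0 (trIMM F w d))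
  simp only [Pi.zero_apply, zero_mul, Finset.sum_const_zero, TrivSqZeroExt.inr_zero, add_zero,
    TrivSqZeroExt.snd_inl] at h0
  rw [mem_lieAlg_iff, ← h0, aeval_trIMM, aeval_trIMM,
    ← trace_list_prod_of_isRotated (h.map _), ← trace_list_prod_of_isRotated (h.map _),
    trace_prod_gaugeMatrix (h.nodup_iff.2 (List.nodup_finRange d))]

theorem trace_mul_prod_eq_zero_of_mem_lieAlg {F : Type*} [Field F] {w d : ℕ}
    {E : Matrix (Fin d × Fin w × Fin w) (Fin d × Fin w × Fin w) F}
    (hE : E ∈ lieAlg (trIMM F w d)) {k : Fin d} {t : List (Fin d)}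
    (h : (k :: t) ~r List.finRange d) {x : Fin d × Fin w × Fin w → F}
    (hx : ∀ i j, x (k, i, j) = 0) :
    Matrix.trace ((Matrix.of fun i j => (E *ᵥ x) (k, i, j)) *
      (t.map fun m => Matrix.of fun i j => x (m, i, j)).prod) = 0 := by
  have h0 := snd_aeval_of_mem_lieAlg hE x
  rw [aeval_trIMM, ← trace_list_prod_of_isRotated (h.map _), List.map_cons, List.prod_cons] at h0
  simp only [hx, TrivSqZeroExt.inl_zero, zero_add] at h0
  set P := (t.map fun m => (Matrix.of fun i j => TrivSqZeroExt.inl (x (m, i, j)) +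
    TrivSqZeroExt.inr ((E *ᵥ x) (m, i, j)) : Matrix (Fin w) (Fin w) (TrivSqZeroExt F F))).prod
  have hP : (TrivSqZeroExt.fstHom F F F).mapMatrix P =
      (t.map fun m => Matrix.of fun i j => x (m, i, j)).prod := by
    rw [map_list_prod, List.map_map]
    congr 2
    funext m
    ext i j
    simp
  rw [← hP, ← h0]
  simp [Matrix.trace, Matrix.mul_apply, TrivSqZeroExt.snd_sum]

theorem List.prod_map_eq_mul_or {α : Type*} [DecidableEq α] {t : List α} (ht : t.Nodup) {a b : α}
    (ha : a ∈ t) (hb : b ∈ t) (hab : a ≠ b) (M : Type*) [Monoid M] :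
    (∀ f : α → M, (∀ c, c ≠ a → c ≠ b → f c = 1) → (t.map f).prod = f a * f b) ∨
    (∀ f : α → M, (∀ c, c ≠ a → c ≠ b → f c = 1) → (t.map f).prod = f b * f a) := by
  obtain ⟨s, r, rfl⟩ := List.append_of_mem ha
  rw [List.nodup_append, List.nodup_cons] at ht
  obtain ⟨hs, ⟨har, hr⟩, hdis⟩ := ht
  have has : a ∉ s := fun h => hdis a h a List.mem_cons_self rfl
  have key : ∀ (l : List α), l.Nodup → a ∉ l → ∀ f : α → M, (∀ c, c ≠ a → c ≠ b → f c = 1) →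
      (l.map f).prod = if b ∈ l then f b else 1 := by
    intro l hl hal f hf
    rw [List.prod_map_eq_pow_single b f fun c hcb hc => hf c (fun h => hal (h ▸ hc)) hcb]
    split_ifs with h
    · rw [List.count_eq_one_of_mem hl h, pow_one]
    · rw [List.count_eq_zero_of_not_mem h, pow_zero]
  rw [List.mem_append, List.mem_cons] at hb
  rcases hb with hb | hb | hb
  · right
    intro f hf
    have hbr : b ∉ r := fun h => hdis b hb b (List.mem_cons_of_mem _ h) rfl
    simp [key s hs has f hf, key r hr har f hf, hb, hbr]
  · exact absurd hb.symm hab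
  · left
    intro f hf
    have hbs : b ∉ s := fun h => hdis b h b (List.mem_cons_of_mem _ hb) rfl
    simp [key s hs has f hf, key r hr har f hf, hb, hbs]

/-- The point whose only nonzero block is `G`, in position `l`. -/
def blockVec {F : Type*} [Field F] {w d : ℕ} (l : Fin d) (G : Matrix (Fin w) (Fin w) F) :
    Fin d × Fin w × Fin w → F :=
  fun y => if y.1 = l then G y.2.1 y.2.2 else 0

theorem mulVec_blockVec_eq_zero {F : Type*} [Field F] [CharZero F] {w d : ℕ} (hd : 3 ≤ d)
    {E : Matrix (Fin d × Fin w × Fin w) (Fin d × Fin w × Fin w) F}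
    (hE : E ∈ lieAlg (trIMM F w d)) {k l : Fin d} (hkl : k ≠ l)
    {G : Matrix (Fin w) (Fin w) F} (hG : IsUnit G) (i j : Fin w) :
    (E *ᵥ blockVec l G) (k, i, j) = 0 := by
  obtain ⟨t, ht⟩ := exists_isRotated_cons (List.mem_finRange k)
  have hnd : (k :: t).Nodup := ht.nodup_iff.2 (List.nodup_finRange d)
  have hmem : ∀ m, m ≠ k → m ∈ t := fun m hm =>
    (List.mem_cons.1 (ht.mem_iff.2 (List.mem_finRange m))).resolve_left hm
  obtain ⟨m, hmk, hml⟩ : ∃ m : Fin d, m ≠ k ∧ m ≠ l := by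
    have : ({k, l} : Finset (Fin d)).card < Fintype.card (Fin d) := by
      rw [Fintype.card_fin]
      exact (Finset.card_le_two).trans_lt (by omega)
    obtain ⟨m, hm⟩ := Finset.exists_mem_notMem_of_card_lt_card
      (s := {k, l}) (t := Finset.univ) (by simpa using this)
    exact ⟨m, by simpa using hm⟩
  set L : Matrix (Fin w) (Fin w) F := Matrix.of fun i j => (E *ᵥ blockVec l G) (k, i, j) with hL
  set N : Matrix (Fin w) (Fin w) F → Fin d × Fin w × Fin w → F := fun Z y =>
    if y.1 = k ∨ y.1 = l then 0 else if y.1 = m then Z y.2.1 y.2.2 else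
      (1 : Matrix (Fin w) (Fin w) F) y.2.1 y.2.2 with hN
  set C : Matrix (Fin w) (Fin w) F → Matrix (Fin w) (Fin w) F :=
    fun Z => Matrix.of fun i j => (E *ᵥ N Z) (k, i, j) with hC
  have key : ∀ (Z : Matrix (Fin w) (Fin w) F) (c : F),
      Matrix.trace ((c • L + C Z) * (t.map fun a => Matrix.of fun i j =>
        (c • blockVec l G + N Z) (a, i, j)).prod) = 0 := by
    intro Z c
    rw [← trace_mul_prod_eq_zero_of_mem_lieAlg hE ht (x := c • blockVec l G + N Z)
      (by simp [hN, blockVec, hkl])]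
    congr 2
    ext i j
    simp [hL, hC, Matrix.mulVec_add, Matrix.mulVec_smul]
  have hf : ∀ (Z : Matrix (Fin w) (Fin w) F) (c : F),
      (t.map fun a => Matrix.of fun i j => (c • blockVec l G + N Z) (a, i, j)) =
        t.map fun a => if a = l then c • G else if a = m then Z else 1 := by
    intro Z c
    refine List.map_congr_left fun a ha => ?_
    have hak : a ≠ k := by
      rintro rfl
      exact (List.nodup_cons.1 hnd).1 ha
    ext i j
    by_cases hal : a = l
    · simp [hN, blockVec, hal]
    · by_cases ham : a = m <;> simp [hN, blockVec, hal, ham, hmk, hml, hak]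
  have htwo : (2 : F) ≠ 0 := two_ne_zero
  have hL0 : L = 0 := by
    rcases List.prod_map_eq_mul_or (List.nodup_cons.1 hnd).2 (hmem l hkl.symm) (hmem m hmk)
      hml.symm (Matrix (Fin w) (Fin w) F) with h | h
    · have : L * G = 0 := by
        refine Matrix.ext_iff_trace_mul_right.2 fun Z => ?_
        have h1 := key Z 1
        have h2 := key Z (-1)
        rw [hf, h _ (by intro c h1 h2; simp [h1, h2])] at h1 h2
        simp only [if_true, if_neg hml, one_smul, neg_smul, neg_mul, mul_neg, add_mul,
          Matrix.trace_add, Matrix.trace_neg, ← mul_assoc] at h1 h2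
        rw [zero_mul, Matrix.trace_zero]
        exact mul_left_cancel₀ htwo (by linear_combination h1 + h2)
      exact (hG.mul_left_eq_zero).1 this
    · have : G * L = 0 := by
        refine Matrix.ext_iff_trace_mul_right.2 fun Z => ?_
        have h1 := key Z 1
        have h2 := key Z (-1)
        rw [hf, h _ (by intro c h1 h2; simp [h1, h2])] at h1 h2
        simp only [if_true, if_neg hml, one_smul, neg_smul, neg_mul, mul_neg, add_mul,
          Matrix.trace_add, Matrix.trace_neg, ← mul_assoc] at h1 h2
        rw [zero_mul, Matrix.trace_zero, mul_assoc, Matrix.trace_mul_comm]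
        exact mul_left_cancel₀ htwo (by linear_combination h1 + h2)
      exact (hG.mul_right_eq_zero).1 this
  exact congrFun (congrFun hL0 i) j

theorem isUnit_one_add_single {F n : Type*} [Field F] [CharZero F] [Fintype n] [DecidableEq n]
    (p q : n) : IsUnit (1 + Matrix.single p q (1 : F)) := by
  rw [Matrix.isUnit_iff_isUnit_det]
  by_cases h : p = q
  · subst h
    rw [← Matrix.diagonal_one, ← Matrix.diagonal_single, Matrix.diagonal_add, Matrix.det_diagonal,
      isUnit_iff_ne_zero, Finset.prod_ne_zero_iff]
    intro a _
    by_cases ha : a = p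
    · subst ha
      simp [one_add_one_eq_two]
    · simp [ha]
  · simpa [Matrix.transvection] using congrArg IsUnit (Matrix.det_transvection_of_ne p q h (1 : F))

/-- The Lie algebra of `Tr-IMM` consists of block-diagonal matrices. -/
theorem apply_eq_zero_of_mem_lieAlg {F : Type*} [Field F] [CharZero F] {w d : ℕ} (hd : 3 ≤ d)
    {E : Matrix (Fin d × Fin w × Fin w) (Fin d × Fin w × Fin w) F}
    (hE : E ∈ lieAlg (trIMM F w d)) {x y : Fin d × Fin w × Fin w} (hxy : x.1 ≠ y.1) :
    E x y = 0 := by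
  obtain ⟨k, i, j⟩ := x
  obtain ⟨l, p, q⟩ := y
  have h1 := mulVec_blockVec_eq_zero hd hE hxy isUnit_one i j
  have h2 := mulVec_blockVec_eq_zero hd hE hxy (isUnit_one_add_single p q) i j
  have hadd : blockVec l (1 + Matrix.single p q (1 : F)) =
      blockVec l (1 : Matrix (Fin w) (Fin w) F) + Pi.single (l, p, q) 1 := by
    ext ⟨a, b, c⟩
    by_cases ha : a = l
    · simp [blockVec, ha, Matrix.single_apply, Pi.single_apply, eq_comm]
    · simp [blockVec, ha]
  rw [hadd, Matrix.mulVec_add, Pi.add_apply, h1, zero_add] at h2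
  simpa using h2

theorem gaugeMatrix_mulVec {F : Type*} [Field F] {w d : ℕ} (p q : Fin d)
    (A : Matrix (Fin w) (Fin w) F) (u : Fin d × Fin w × Fin w → F) (k : Fin d) (i j : Fin w) :
    (gaugeMatrix p q A *ᵥ u) (k, i, j) =
      (if k = p then ∑ a, A a j * u (p, i, a) else 0) -
      (if k = q then ∑ a, A i a * u (q, a, j) else 0) :=
  sum_gaugeMatrix_smul p q A u k i j

theorem gaugeMatrix_single_mulVec {F : Type*} [Field F] {w d : ℕ} (p q : Fin d) (a b : Fin w)
    (u : Fin d × Fin w × Fin w → F) (k : Fin d) (i j : Fin w) :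
    (gaugeMatrix p q (Matrix.single a b 1) *ᵥ u) (k, i, j) =
      (if k = p ∧ j = b then u (p, i, a) else 0) -
      (if k = q ∧ i = a then u (q, b, j) else 0) := by
  rw [gaugeMatrix_mulVec]
  congr 1
  · by_cases hk : k = p <;> by_cases hj : j = b <;>
      simp [hk, hj, Matrix.single_apply, Ne.symm]
  · by_cases hk : k = q <;> by_cases hi : i = a <;>
      simp [hk, hi, Matrix.single_apply, Ne.symm]

theorem LieInvariant.column_row_mem {F : Type*} [Field F] [CharZero F] {w d : ℕ}
    {U : Submodule F (Fin d × Fin w × Fin w → F)} (hU : LieInvariant (lieAlg (trIMM F w d)) U)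
    {p q : Fin d} {t : List (Fin d)} (h : (p :: q :: t) ~r List.finRange d)
    {u : Fin d × Fin w × Fin w → F} (hu : u ∈ U) (a : Fin w) :
    (fun x => if x.1 = p ∧ x.2.2 = a then u x else 0) ∈ U ∧
      (fun x => if x.1 = q ∧ x.2.1 = a then u x else 0) ∈ U := by
  have hpq : p ≠ q := by
    rintro rfl
    simpa using h.nodup_iff.2 (List.nodup_finRange d)
  set T := gaugeMatrix p q (Matrix.single a a (1 : F)) with hT
  have hTmem : T ∈ lieAlg (trIMM F w d) := gaugeMatrix_mem_lieAlg h _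
  have h1 := hU T hTmem u hu
  have h2 := hU T hTmem _ h1
  have htwo : (2 : F) ≠ 0 := two_ne_zero
  constructor
  · convert U.smul_mem (2⁻¹ : F) (U.add_mem h2 h1) using 1
    ext ⟨k, i, j⟩
    simp only [Pi.smul_apply, Pi.add_apply, hT, gaugeMatrix_single_mulVec, smul_eq_mul]
    by_cases hkp : k = p
    · by_cases hj : j = a
      · simp [hkp, hpq, hj]
        field_simp
        ring
      · simp [hkp, hpq, hj]
    · by_cases hkq : k = q
      · by_cases hi : i = a <;> simp [hkq, hpq.symm, hi]
      · simp [hkp, hkq]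
  · convert U.smul_mem (2⁻¹ : F) (U.sub_mem h2 h1) using 1
    ext ⟨k, i, j⟩
    simp only [Pi.smul_apply, Pi.sub_apply, hT, gaugeMatrix_single_mulVec, smul_eq_mul]
    by_cases hkq : k = q
    · by_cases hi : i = a
      · simp [hkq, hpq.symm, hi]
        field_simp
        ring
      · simp [hkq, hpq.symm, hi]
    · by_cases hkp : k = p
      · by_cases hj : j = a <;> simp [hkp, hpq, hj]
      · simp [hkp, hkq]

theorem exists_isRotated_succ {d : ℕ} (hd : 2 ≤ d) (k : Fin d) :
    ∃ n t, (k :: n :: t) ~r List.finRange d := by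
  obtain ⟨t, ht⟩ := exists_isRotated_cons (List.mem_finRange k)
  cases t with
  | nil =>
    have := ht.perm.length_eq
    simp at this
    omega
  | cons n t => exact ⟨n, t, ht⟩

theorem exists_isRotated_pred {d : ℕ} (hd : 2 ≤ d) (k : Fin d) :
    ∃ p t, (p :: k :: t) ~r List.finRange d := by
  obtain ⟨t, ht⟩ := exists_isRotated_cons (List.mem_finRange k)
  rcases List.eq_nil_or_concat t with rfl | ⟨s, p, rfl⟩
  · have := ht.perm.length_eq
    simp at this
    omega
  · refine ⟨p, s, List.IsRotated.trans ?_ ht⟩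
    simpa using List.isRotated_append (l := [p]) (l' := k :: s)

/-- The coordinate subspace of vectors supported on the blocks in `S`. -/
def blockSubmodule (F : Type*) [Field F] {w d : ℕ} (S : Set (Fin d)) :
    Submodule F (Fin d × Fin w × Fin w → F) where
  carrier := {u | ∀ x, x.1 ∉ S → u x = 0}
  add_mem' hu hv x hx := by simp [hu x hx, hv x hx]
  zero_mem' _ _ := rfl
  smul_mem' c u hu x hx := by simp [hu x hx]

theorem mem_blockSubmodule {F : Type*} [Field F] {w d : ℕ} {S : Set (Fin d)}
    {u : Fin d × Fin w × Fin w → F} :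
    u ∈ blockSubmodule F S ↔ ∀ x, x.1 ∉ S → u x = 0 :=
  Iff.rfl

theorem single_mem_blockSubmodule {F : Type*} [Field F] {w d : ℕ} {S : Set (Fin d)}
    {x : Fin d × Fin w × Fin w} (hx : x.1 ∈ S) (c : F) :
    (Pi.single x c : Fin d × Fin w × Fin w → F) ∈ blockSubmodule F S := by
  intro y hy
  refine Pi.single_eq_of_ne (M := fun _ => F) ?_ c
  rintro rfl
  exact hy hx

theorem blockSubmodule_singleton_le {F : Type*} [Field F] {w d : ℕ} {k : Fin d}
    {V : Submodule F (Fin d × Fin w × Fin w → F)}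
    (h : ∀ i j, (Pi.single (k, i, j) 1 : Fin d × Fin w × Fin w → F) ∈ V) :
    blockSubmodule F {k} ≤ V := by
  intro u hu
  rw [pi_eq_sum_univ' u]
  refine V.sum_mem fun x _ => ?_
  obtain ⟨l, i, j⟩ := x
  by_cases hl : l = k
  · subst hl
    convert V.smul_mem (u (l, i, j)) (h i j) using 1
  · simp [hu (l, i, j) hl]

theorem span_single_eq_blockSubmodule {F : Type*} [Field F] {w d : ℕ} (k : Fin d) :
    Submodule.span F {v : Fin d × Fin w × Fin w → F | ∃ i j : Fin w,
      v = Pi.single ((k, i, j) : Fin d × Fin w × Fin w) (1 : F)} = blockSubmodule F {k} := by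
  refine le_antisymm (Submodule.span_le.2 ?_)
    (blockSubmodule_singleton_le fun i j => Submodule.subset_span ⟨i, j, rfl⟩)
  rintro _ ⟨i, j, rfl⟩
  exact single_mem_blockSubmodule (Set.mem_singleton k) (1 : F)

theorem lieInvariant_blockSubmodule {F : Type*} [Field F] [CharZero F] {w d : ℕ} (hd : 3 ≤ d)
    (S : Set (Fin d)) :
    LieInvariant (lieAlg (trIMM F w d)) (blockSubmodule F (w := w) S) := by
  intro E hE u hu x hx
  refine Finset.sum_eq_zero fun y _ => ?_
  change E x y * u y = 0
  by_cases hxy : x.1 = y.1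
  · rw [hu y (hxy ▸ hx), mul_zero]
  · rw [apply_eq_zero_of_mem_lieAlg hd hE hxy, zero_mul]

theorem LieInvariant.blockSubmodule_le {F : Type*} [Field F] [CharZero F] {w d : ℕ} (hd : 2 ≤ d)
    {U : Submodule F (Fin d × Fin w × Fin w → F)} (hU : LieInvariant (lieAlg (trIMM F w d)) U)
    {u : Fin d × Fin w × Fin w → F} (hu : u ∈ U) {x : Fin d × Fin w × Fin w} (hx : u x ≠ 0) :
    blockSubmodule F {x.1} ≤ U := by
  obtain ⟨k, a, b⟩ := x
  obtain ⟨n, t, ht⟩ := exists_isRotated_succ hd k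
  obtain ⟨p, s, hs⟩ := exists_isRotated_pred hd k
  have hkn : k ≠ n := by
    rintro rfl
    simpa using ht.nodup_iff.2 (List.nodup_finRange d)
  have hpk : p ≠ k := by
    rintro rfl
    simpa using hs.nodup_iff.2 (List.nodup_finRange d)
  have h0 : (Pi.single (k, a, b) 1 : Fin d × Fin w × Fin w → F) ∈ U := by
    have h := (hU.column_row_mem hs (hU.column_row_mem ht hu b).1 a).2
    convert U.smul_mem (u (k, a, b))⁻¹ h using 1
    ext ⟨l, i, j⟩
    by_cases h : (l, i, j) = (k, a, b)
    · obtain ⟨rfl, rfl, rfl⟩ : l = k ∧ i = a ∧ j = b := by simpa using h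
      simp [hx]
    · have h' : ¬ ((l = k ∧ i = a) ∧ l = k ∧ j = b) := fun ⟨⟨h1, h2⟩, _, h3⟩ =>
        h (by rw [h1, h2, h3])
      rw [Pi.single_eq_of_ne h]
      simp [← ite_and, h']
  refine blockSubmodule_singleton_le fun i j => ?_
  have h1 : (Pi.single (k, a, j) 1 : Fin d × Fin w × Fin w → F) ∈ U := by
    convert hU _ (gaugeMatrix_mem_lieAlg ht (Matrix.single b j 1)) _ h0 using 1
    ext ⟨l, c, e⟩
    rw [gaugeMatrix_single_mulVec]
    by_cases hl : l = k <;> by_cases hc : c = a <;> by_cases he : e = j <;>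
      simp [hl, hc, he, hkn, hkn.symm]
  have h2 := hU _ (gaugeMatrix_mem_lieAlg hs (Matrix.single i a 1)) _ h1
  convert U.neg_mem h2 using 1
  ext ⟨l, c, e⟩
  rw [Pi.neg_apply, gaugeMatrix_single_mulVec]
  by_cases hl : l = k <;> by_cases hc : c = i <;> by_cases he : e = j <;>
    simp [hl, hc, he, hpk, hpk.symm]

theorem stmt13 (F : Type*) [Field F] [CharZero F] (w d : ℕ) (hw : 2 ≤ w) (hd : 3 ≤ d)
    (U : Submodule F (Fin d × Fin w × Fin w → F)) :
    IsIrreducibleInvariant (lieAlg (trIMM F w d)) U ↔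
      ∃ k : Fin d, U = Submodule.span F
        {v : Fin d × Fin w × Fin w → F | ∃ i j : Fin w,
          v = Pi.single ((k, i, j) : Fin d × Fin w × Fin w) (1 : F)} := by
  simp only [span_single_eq_blockSubmodule]
  have hd2 : 2 ≤ d := by omega
  have hne : ∀ k : Fin d, blockSubmodule F (w := w) {k} ≠ ⊥ := fun k h => by
    have h1 : (Pi.single (k, ⟨0, by omega⟩, ⟨0, by omega⟩) 1 : Fin d × Fin w × Fin w → F) ∈
      blockSubmodule F {k} :=
        single_mem_blockSubmodule (Set.mem_singleton k) 1
    rw [h, Submodule.mem_bot] at h1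
    simp at h1
  constructor
  · rintro ⟨hU0, hU, hind⟩
    obtain ⟨u, hu, hu0⟩ := U.ne_bot_iff.1 hU0
    obtain ⟨x, hx⟩ := Function.ne_iff.1 hu0
    have hle := hU.blockSubmodule_le hd2 hu hx
    refine ⟨x.1, by_contra fun hne' => hind ?_⟩
    have hlt : blockSubmodule F {x.1} < U := lt_of_le_of_ne hle (Ne.symm hne')
    obtain ⟨v, hv, hvn⟩ := SetLike.exists_of_lt hlt
    obtain ⟨y, hyx, hy⟩ : ∃ y, y.1 ∉ ({x.1} : Set (Fin d)) ∧ v y ≠ 0 := by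
      simpa [mem_blockSubmodule] using hvn
    have hle' := hU.blockSubmodule_le hd2 hv hy
    have hdisj : blockSubmodule F {x.1} ⊓ (U ⊓ blockSubmodule F {x.1}ᶜ) = ⊥ := by
      rw [Submodule.eq_bot_iff]
      rintro z ⟨hz1, -, hz2⟩
      funext s
      by_cases hs : s.1 ∈ ({x.1} : Set (Fin d))
      · exact hz2 s fun h => h hs
      · exact hz1 s hs
    refine ⟨blockSubmodule F {x.1}, U ⊓ blockSubmodule F {x.1}ᶜ,
      lieInvariant_blockSubmodule hd _, fun M hM z hz =>
        ⟨hU M hM z hz.1, lieInvariant_blockSubmodule hd _ M hM z hz.2⟩, hne _, ?_, hlt, ?_, ?_,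
      hdisj⟩
    · refine ne_bot_of_le_ne_bot (hne y.1) (le_inf hle' fun z hz s hs => hz s ?_)
      intro h
      rw [Set.mem_singleton_iff] at h
      exact hs (h ▸ hyx)
    · refine lt_of_le_of_ne inf_le_left fun h => hne x.1 ?_
      rwa [h, inf_eq_left.2 hle] at hdisj
    · refine le_antisymm (sup_le hle inf_le_left) fun z hz => ?_
      have hz1 : (fun s => if s.1 = x.1 then z s else 0) ∈ blockSubmodule F {x.1} :=
        fun s hs => if_neg hs
      refine Submodule.mem_sup.2 ⟨_, hz1, z - fun s => if s.1 = x.1 then z s else 0,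
        ⟨U.sub_mem hz (hle hz1), fun s hs => ?_⟩, by simp⟩
      have hs' : s.1 = x.1 := by simpa using hs
      simp [hs']
  · rintro ⟨k, rfl⟩
    refine ⟨hne k, lieInvariant_blockSubmodule hd _, ?_⟩
    rintro ⟨U₁, -, hU₁, -, h0, -, hlt, -, -, -⟩
    obtain ⟨u, hu, hu0⟩ := U₁.ne_bot_iff.1 h0
    obtain ⟨x, hx⟩ := Function.ne_iff.1 hu0
    obtain rfl : x.1 = k := by_contra fun h => hx (hlt.le hu x h)
    exact hlt.not_ge (hU₁.blockSubmodule_le hd2 hu hx)
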